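/- If m ∈ G(I^k), s ∈ set(m), and x_s·m/x_{min(m)} ⪰ v^k, then g(x_s·m) = x_s·m/x_{min(m)}; that is, x_s·m/x_{min(m)} ∈ G(I^k) and every w ∈ G(I^k) dividing x_s·m satisfies w ≥_revlex x_s·m/x_{min(m)}. -/

import Mathlib

open MvPolynomial Finset

/-- A monomial in `n` variables, recorded by its exponent vector
(index `i : Fin n` corresponds to the variable `x_{i+1}` of the paper). -/
abbrev Mon (n : ℕ) := Fin n →₀ ℕ

/-- The exponent vector of the single variable `x_{j+1}` (`0`-indexed `j`). -/
noncomputable def sing (n j : ℕ) : Mon n :=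
  Finsupp.onFinset Finset.univ (fun i => if (i : ℕ) = j then 1 else 0)
    (fun a _ => Finset.mem_univ a)

/-- Total degree of a monomial. -/
def deg {n : ℕ} (m : Mon n) : ℕ := m.sum fun _ e => e

/-- `m₁ <_lex m₂` for the lexicographic order with `x_1 > x_2 > ⋯ > x_n`. -/
def lexLT {n : ℕ} (m₁ m₂ : Mon n) : Prop :=
  ∃ i : Fin n, (∀ j : Fin n, j < i → m₁ j = m₂ j) ∧ m₁ i < m₂ i

def lexLE {n : ℕ} (m₁ m₂ : Mon n) : Prop := m₁ = m₂ ∨ lexLT m₁ m₂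

/-- `m₁ <_revlex m₂` : the increasing reverse lexicographic order. -/
def revLT {n : ℕ} (m₁ m₂ : Mon n) : Prop :=
  ∃ s : Fin n, (∀ i : Fin n, s < i → m₁ i = m₂ i) ∧ m₂ s < m₁ s

def revLE {n : ℕ} (m₁ m₂ : Mon n) : Prop := m₁ = m₂ ∨ revLT m₁ m₂

/-- `min(m)`: the (0-indexed) smallest index in the support of `m`. -/
noncomputable def minIdx {n : ℕ} (m : Mon n) : ℕ := sInf {j : ℕ | ∃ h : j < n, m ⟨j, h⟩ ≠ 0}

/-- `m̄`: the part of `m` supported in the variables `x_1, …, x_l`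
(0-indexed: indices `< l`). -/
noncomputable def lowPart {n : ℕ} (l : ℕ) (m : Mon n) : Mon n :=
  m.filter fun i => (i : ℕ) < l

/-- `m̃`: the part of `m` supported in the variables `x_{l+1}, …, x_n`
(0-indexed: indices `≥ l`). -/
noncomputable def highPart {n : ℕ} (l : ℕ) (m : Mon n) : Mon n :=
  m.filter fun i => l ≤ (i : ℕ)

/-- The exponent vector of `u = x_1 · x_{l+1}^{a_{l+1}} ⋯ x_n^{a_n}`, where
`a j` (for `l ≤ j < n`, 0-indexed) is the exponent of `x_{j+1}`. -/
noncomputable def uVec (n l : ℕ) (a : ℕ → ℕ) : Mon n :=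
  sing n 0 + ∑ j ∈ Finset.Ico l n, a j • sing n j

/-- The exponent vector of `v = x_l · x_n^{d-1}`. -/
noncomputable def vVec (n l d : ℕ) : Mon n :=
  sing n (l - 1) + (d - 1) • sing n (n - 1)

/-- The lexsegment `L(u,v)`: monomials `w` of degree `d` with `u ≥_lex w ≥_lex v`. -/
def lexSeg (n l d : ℕ) (a : ℕ → ℕ) : Set (Mon n) :=
  { w | deg w = d ∧ lexLE (vVec n l d) w ∧ lexLE w (uVec n l a) }

/-- The lexsegment ideal `I = (L(u,v)) ⊆ K[x_1,…,x_n]`. -/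
noncomputable def lexIdeal (n l d : ℕ) (a : ℕ → ℕ) (K : Type*) [Field K] :
    Ideal (MvPolynomial (Fin n) K) :=
  Ideal.span ((fun w => monomial w (1 : K)) '' lexSeg n l d a)

/-- `G(J)`: the minimal monomial generators of a monomial ideal `J`, i.e.
monomials `m ∈ J` with `m / x_i ∉ J` for every `i ∈ supp m`. -/
def minGens {n : ℕ} (K : Type*) [Field K] (J : Ideal (MvPolynomial (Fin n) K)) :
    Set (Mon n) :=
  { m | monomial m (1 : K) ∈ J ∧
      ∀ i ∈ m.support, monomial (m - Finsupp.single i 1) (1 : K) ∉ J }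

/-- `J_{<revlex m}`: the ideal generated by all `z ∈ G(J)` with `z <_revlex m`. -/
noncomputable def idealBelow {n : ℕ} (K : Type*) [Field K]
    (J : Ideal (MvPolynomial (Fin n) K)) (m : Mon n) : Ideal (MvPolynomial (Fin n) K) :=
  Ideal.span ((fun z => monomial z (1 : K)) '' { z | z ∈ minGens K J ∧ revLT z m })

/-- `set(m) = {j : x_j · m ∈ J_{<revlex m}}` (0-indexed). -/
def setOfGen {n : ℕ} (K : Type*) [Field K] (J : Ideal (MvPolynomial (Fin n) K))
    (m : Mon n) : Set ℕ :=
  { j | j < n ∧ monomial (m + sing n j) (1 : K) ∈ idealBelow K J m }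

/-- The order `≺` on monomials: compare first the degree of the part supported in
`x_1,…,x_l`, then `<_lex`. -/
def precLT {n : ℕ} (l : ℕ) (m₁ m₂ : Mon n) : Prop :=
  deg (lowPart l m₁) < deg (lowPart l m₂) ∨
    (deg (lowPart l m₁) = deg (lowPart l m₂) ∧ lexLT m₁ m₂)

/-- `w = g(z)`: `w` is the `<_revlex`-smallest minimal monomial generator of `J`
dividing the monomial `z` (the value of the decomposition function). -/
def isDecompOf {n : ℕ} (K : Type*) [Field K] (J : Ideal (MvPolynomial (Fin n) K))
    (z w : Mon n) : Prop :=
  w ∈ minGens K J ∧ w ≤ z ∧ ∀ w' ∈ minGens K J, w' ≤ z → revLE w w'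

section aux

lemma sing_app (n j : ℕ) (i : Fin n) : sing n j i = if (i : ℕ) = j then 1 else 0 := rfl

lemma deg_eq {n : ℕ} (m : Mon n) : deg m = ∑ i, m i :=
  Finsupp.sum_fintype _ _ (fun _ => rfl)

lemma low_eq {n : ℕ} (l : ℕ) (m : Mon n) :
    deg (lowPart l m) = ∑ i : Fin n, if (i : ℕ) < l then m i else 0 := by
  rw [deg_eq]
  refine Finset.sum_congr rfl fun i _ => ?_
  simp [lowPart, Finsupp.filter_apply]

lemma deg_add {n : ℕ} (x y : Mon n) : deg (x + y) = deg x + deg y := by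
  simp [deg_eq, Finset.sum_add_distrib]

lemma low_add {n : ℕ} (l : ℕ) (x y : Mon n) :
    deg (lowPart l (x + y)) = deg (lowPart l x) + deg (lowPart l y) := by
  rw [lowPart, Finsupp.filter_add, deg_add]; rfl

lemma deg_sing {n j : ℕ} (h : j < n) : deg (sing n j) = 1 := by
  rw [deg_eq, Finset.sum_eq_single (⟨j, h⟩ : Fin n)]
  · simp [sing_app]
  · intro b _ hb
    rw [sing_app, if_neg]
    intro h'; exact hb (Fin.ext h')
  · simp

lemma low_sing {n l j : ℕ} (h : j < n) :
    deg (lowPart l (sing n j)) = if j < l then 1 else 0 := by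
  rw [low_eq, Finset.sum_eq_single (⟨j, h⟩ : Fin n)]
  · simp [sing_app]
  · intro b _ hb
    rw [sing_app, if_neg (fun h' => hb (Fin.ext h'))]
    simp
  · simp

lemma sub_add_sing {n : ℕ} (e : Mon n) (s : ℕ) (t : Fin n) (ht : 1 ≤ e t) :
    (e + sing n s - sing n t) + sing n t = e + sing n s := by
  ext i
  simp only [Finsupp.add_apply, Finsupp.tsub_apply, sing_app]
  by_cases h : (i : ℕ) = t
  · have : i = t := Fin.ext h
    subst this
    simp only [if_true]
    omega
  · simp [h]

lemma deg_swap {n : ℕ} (e : Mon n) (s : ℕ) (hs : s < n) (t : Fin n) (ht : 1 ≤ e t) :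
    deg (e + sing n s - sing n t) = deg e := by
  have := congrArg deg (sub_add_sing e s t ht)
  rw [deg_add, deg_add, deg_sing hs, deg_sing t.2] at this
  omega

lemma exists_of_low {n l : ℕ} (m : Mon n) (h : 1 ≤ deg (lowPart l m)) :
    ∃ i : Fin n, (i : ℕ) < l ∧ 1 ≤ m i := by
  by_contra! hc
  rw [low_eq, Finset.sum_eq_zero] at h
  · omega
  · intro i _
    split_ifs with hi
    · have := hc i hi; omega
    · rfl

lemma u_app {n l : ℕ} (a : ℕ → ℕ) (i : Fin n) (hi : (i : ℕ) < l) :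
    uVec n l a i = if (i : ℕ) = 0 then 1 else 0 := by
  rw [uVec, Finsupp.add_apply, Finsupp.finsetSum_apply, sing_app, Finset.sum_eq_zero]
  · simp
  · intro j hj
    rw [Finset.mem_Ico] at hj
    rw [Finsupp.smul_apply, sing_app, if_neg (by omega)]
    simp

lemma v_app (n l d : ℕ) (i : Fin n) :
    vVec n l d i = (if (i : ℕ) = l - 1 then 1 else 0) + (if (i : ℕ) = n - 1 then d - 1 else 0) := by
  simp [vVec, sing_app]

lemma first_diff {n : ℕ} (x y : Mon n) (h : x ≠ y) :
    ∃ j : Fin n, (∀ i, i < j → x i = y i) ∧ x j ≠ y j := by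
  classical
  have hne : (Finset.univ.filter fun i => x i ≠ y i).Nonempty := by
    by_contra hc
    rw [Finset.not_nonempty_iff_eq_empty, Finset.filter_eq_empty_iff] at hc
    exact h (Finsupp.ext fun i => by simpa using hc (Finset.mem_univ i))
  refine ⟨_, ?_, (Finset.mem_filter.1 (Finset.min'_mem _ hne)).2⟩
  intro i hi
  by_contra hc
  exact absurd (Finset.min'_le _ i (by simp [hc])) (not_le.2 hi)

lemma last_diff {n : ℕ} (x y : Mon n) (h : x ≠ y) :
    ∃ j : Fin n, (∀ i, j < i → x i = y i) ∧ x j ≠ y j := by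
  classical
  have hne : (Finset.univ.filter fun i => x i ≠ y i).Nonempty := by
    by_contra hc
    rw [Finset.not_nonempty_iff_eq_empty, Finset.filter_eq_empty_iff] at hc
    exact h (Finsupp.ext fun i => by simpa using hc (Finset.mem_univ i))
  refine ⟨_, ?_, (Finset.mem_filter.1 (Finset.max'_mem _ hne)).2⟩
  intro i hi
  by_contra hc
  exact absurd (Finset.le_max' _ i (by simp [hc])) (not_le.2 hi)

lemma deg_lt_of {n : ℕ} (x y : Mon n) (h : ∀ i, x i ≤ y i) (j : Fin n) (hj : x j < y j) :
    deg x < deg y := by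
  rw [deg_eq, deg_eq]
  exact Finset.sum_lt_sum (fun i _ => h i) ⟨j, Finset.mem_univ _, hj⟩

lemma deg_v {n l d : ℕ} (hd : 2 ≤ d) (hl2 : 2 ≤ l) (hln : l ≤ n - 1) : deg (vVec n l d) = d := by
  rw [vVec, deg_add, deg_sing (by omega)]
  have : deg ((d - 1) • sing n (n - 1)) = d - 1 := by
    have h1 := deg_sing (n := n) (j := n - 1) (by omega)
    rw [deg_eq] at h1 ⊢
    simp only [Finsupp.smul_apply, smul_eq_mul]
    rw [← Finset.mul_sum, h1, mul_one]
  omega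

lemma low_v {n l d : ℕ} (hl2 : 2 ≤ l) (hln : l ≤ n - 1) : deg (lowPart l (vVec n l d)) = 1 := by
  rw [low_eq, Finset.sum_eq_single (⟨l - 1, by omega⟩ : Fin n)]
  · rw [v_app]
    simp only [if_true]
    rw [if_pos (by omega), if_neg (by omega)]
  · intro b _ hb
    have : (b : ℕ) ≠ l - 1 := fun h' => hb (Fin.ext h')
    rw [v_app, if_neg this]
    split_ifs <;> omega
  · simp

lemma low_smul {n : ℕ} (l k : ℕ) (x : Mon n) :
    deg (lowPart l (k • x)) = k * deg (lowPart l x) := by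
  rw [low_eq, low_eq, Finset.mul_sum]
  refine Finset.sum_congr rfl fun i _ => ?_
  split_ifs <;> simp

/-- Sufficient condition for membership in the lexsegment. -/
lemma mem_seg {n l d : ℕ} {a : ℕ → ℕ} (hd : 2 ≤ d) (hl2 : 2 ≤ l) (hln : l ≤ n - 1)
    (w : Mon n) (hw : deg w = d) (h0 : ∀ i : Fin n, (i : ℕ) = 0 → w i = 0)
    (hlow : 1 ≤ deg (lowPart l w)) : w ∈ lexSeg n l d a := by
  refine ⟨hw, ?_, ?_⟩
  · by_cases he : vVec n l d = w
    · exact Or.inl he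
    right
    obtain ⟨j, hj, hne⟩ := first_diff _ _ he
    refine ⟨j, hj, ?_⟩
    by_contra hc
    have hlt : w j < vVec n l d j := by omega
    by_cases hjn : (j : ℕ) = n - 1
    · have := deg_lt_of w (vVec n l d) (fun i => by
        rcases lt_or_ge i j with h | h
        · exact (hj i h).ge
        · have : i = j := Fin.ext (by have := i.2; have : (j : ℕ) ≤ i := h; omega)
          subst this; exact hlt.le) j hlt
      rw [deg_v hd hl2 hln] at this
      omega
    · have hvj := v_app n l d j
      rw [if_neg hjn] at hvj
      by_cases hjl : (j : ℕ) = l - 1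
      · rw [if_pos hjl] at hvj
        obtain ⟨i, hi, hwi⟩ := exists_of_low w hlow
        by_cases hij : i = j
        · subst hij; omega
        · have hij' : i < j := by
            have : (i : ℕ) ≠ j := fun h => hij (Fin.ext h)
            exact Fin.lt_def.2 (by omega)
          have := hj i hij'
          rw [v_app, if_neg (by have : (i : ℕ) < j := hij'; omega), if_neg (by omega)] at this
          omega
      · rw [if_neg hjl] at hvj
        omega
  · right
    refine ⟨⟨0, by omega⟩, ?_, ?_⟩
    · intro j hj
      exact absurd (Fin.lt_def.1 hj) (by simp)
    · rw [h0 _ rfl, u_app _ _ (by simp; omega)]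
      simp

/-- Necessary condition for membership in the lexsegment. -/
lemma seg_prop {n l d : ℕ} {a : ℕ → ℕ} (hl2 : 2 ≤ l) (hln : l ≤ n - 1)
    (w : Mon n) (hw : w ∈ lexSeg n l d a) :
    1 ≤ deg (lowPart l w) ∧
      ((∀ i : Fin n, (i : ℕ) = 0 → w i = 0) ∨
        ∀ i : Fin n, (i : ℕ) < l → w i = if (i : ℕ) = 0 then 1 else 0) := by
  obtain ⟨hdeg, hv, hu⟩ := hw
  constructor
  · by_contra hc
    have hz : ∀ i : Fin n, (i : ℕ) < l → w i = 0 := by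
      intro i hi
      have h1 : deg (lowPart l w) = 0 := by omega
      rw [low_eq, Finset.sum_eq_zero_iff] at h1
      simpa [hi] using h1 i (Finset.mem_univ _)
    have hvl : vVec n l d ⟨l - 1, by omega⟩ ≥ 1 := by
      rw [v_app]; simp
    rcases hv with h | ⟨i, hi, hlt⟩
    · rw [h, hz _ (by simp; omega)] at hvl
      omega
    · rcases lt_or_ge (i : ℕ) l with h | h
      · rw [hz i h] at hlt; omega
      · rw [hi ⟨l - 1, by omega⟩ (Fin.lt_def.2 (by simp; omega)), hz _ (by simp; omega)] at hvl
        omega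
  · rcases hu with h | ⟨i, hi, hlt⟩
    · right
      intro i hi
      rw [h, u_app _ _ hi]
    · by_cases hi0 : (i : ℕ) = 0
      · left
        intro j hj
        have : j = i := Fin.ext (by omega)
        subst this
        rw [u_app _ _ (by omega), if_pos hj] at hlt
        omega
      · right
        have hil : l ≤ (i : ℕ) := by
          by_contra hc
          rw [u_app _ _ (by omega), if_neg hi0] at hlt
          omega
        intro j hj
        rw [hi j (Fin.lt_def.2 (by omega)), u_app _ _ hj]

lemma zero_of_low_two {n l d : ℕ} {a : ℕ → ℕ} (hl2 : 2 ≤ l) (hln : l ≤ n - 1)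
    (w : Mon n) (hw : w ∈ lexSeg n l d a) (h2 : 2 ≤ deg (lowPart l w)) :
    ∀ i : Fin n, (i : ℕ) = 0 → w i = 0 := by
  rcases (seg_prop hl2 hln w hw).2 with h | h
  · exact h
  · exfalso
    have h1 : deg (lowPart l w) = 1 := by
      rw [low_eq, Finset.sum_eq_single (⟨0, by omega⟩ : Fin n)]
      · rw [if_pos (by simp; omega), h _ (by simp; omega)]; simp
      · intro b _ hb
        have : (b : ℕ) ≠ 0 := fun h' => hb (Fin.ext h')
        split_ifs with hbl
        · rw [h _ hbl, if_neg this]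
        · rfl
      · simp
    omega

lemma swap_low {n l d : ℕ} {a : ℕ → ℕ} (hd : 2 ≤ d) (hl2 : 2 ≤ l) (hln : l ≤ n - 1)
    (e : Mon n) (he : e ∈ lexSeg n l d a) (t : Fin n) (het : 1 ≤ e t)
    (h0 : (t : ℕ) ≠ 0 → ∀ i : Fin n, (i : ℕ) = 0 → e i = 0) (s : ℕ) (hs1 : 1 ≤ s) (hs : s < l) :
    e + sing n s - sing n t ∈ lexSeg n l d a := by
  have hp := seg_prop hl2 hln e he
  refine mem_seg hd hl2 hln _ ?_ ?_ ?_
  · rw [deg_swap _ _ (by omega) _ het]; exact he.1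
  · intro i hi
    rw [Finsupp.tsub_apply, Finsupp.add_apply, sing_app, sing_app, if_neg (by omega)]
    by_cases ht : (t : ℕ) = 0
    · rw [if_pos (by omega)]
      rcases hp.2 with h | h
      · rw [h i hi]; rfl
      · rw [h i (by omega), if_pos hi]; rfl
    · rw [h0 ht i hi]; omega
  · have := congrArg (fun x => deg (lowPart l x)) (sub_add_sing e s t het)
    simp only [low_add] at this
    rw [low_sing (show s < n by omega), low_sing t.2, if_pos hs] at this
    have := hp.1
    split_ifs at * <;> omega

lemma swap_high {n l d : ℕ} {a : ℕ → ℕ} (hd : 2 ≤ d) (hl2 : 2 ≤ l) (hln : l ≤ n - 1)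
    (e : Mon n) (he : e ∈ lexSeg n l d a) (t : Fin n) (het : 1 ≤ e t)
    (h2 : 2 ≤ deg (lowPart l e)) (s : ℕ) (hs1 : l ≤ s) (hs : s < n) :
    e + sing n s - sing n t ∈ lexSeg n l d a := by
  have hz := zero_of_low_two hl2 hln e he h2
  refine mem_seg hd hl2 hln _ ?_ ?_ ?_
  · rw [deg_swap _ _ (by omega) _ het]; exact he.1
  · intro i hi
    rw [Finsupp.tsub_apply, Finsupp.add_apply, sing_app, sing_app, if_neg (by omega), hz i hi]
    omega
  · have := congrArg (fun x => deg (lowPart l x)) (sub_add_sing e s t het)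
    simp only [low_add] at this
    rw [low_sing (show s < n by omega), low_sing t.2] at this
    split_ifs at * <;> omega

/-- Sums of `k` elements of a set of monomials. -/
def kSums {n : ℕ} (L : Set (Mon n)) (k : ℕ) : Set (Mon n) :=
  { m | ∃ T : Multiset (Mon n), Multiset.card T = k ∧ (∀ e ∈ T, e ∈ L) ∧ T.sum = m }

lemma span_pow_eq {n : ℕ} (K : Type*) [Field K] (L : Set (Mon n)) (k : ℕ) :
    (Ideal.span ((fun w => monomial w (1 : K)) '' L)) ^ k =
      Ideal.span ((fun w => monomial w (1 : K)) '' kSums L k) := by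
  induction k with
  | zero =>
    rw [pow_zero, Ideal.one_eq_top, eq_comm, Ideal.eq_top_iff_one]
    exact Ideal.subset_span ⟨0, ⟨0, by simp⟩, rfl⟩
  | succ k ih =>
    rw [pow_succ, ih, Ideal.span_mul_span']
    congr 1
    ext p
    rw [Set.mem_mul]
    constructor
    · rintro ⟨_, ⟨x, ⟨T, hT, hL, rfl⟩, rfl⟩, _, ⟨y, hy, rfl⟩, rfl⟩
      refine ⟨T.sum + y, ⟨y ::ₘ T, by simp [hT], ?_, by simp [add_comm]⟩, by simp [monomial_mul]⟩
      intro e he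
      rcases Multiset.mem_cons.1 he with h | h
      · exact h ▸ hy
      · exact hL e h
    · rintro ⟨_, ⟨T, hT, hL, rfl⟩, rfl⟩
      obtain ⟨y, T', rfl⟩ : ∃ y T', T = y ::ₘ T' := by
        obtain ⟨y, hy⟩ := Multiset.card_pos_iff_exists_mem.1 (by omega : 0 < Multiset.card T)
        exact ⟨y, Multiset.exists_cons_of_mem hy⟩
      refine ⟨_, ⟨T'.sum, ⟨T', by simpa using hT, fun e he => hL e (by simp [he]), rfl⟩, rfl⟩,
        _, ⟨y, hL y (by simp), rfl⟩, ?_⟩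
      simp [monomial_mul, add_comm]

lemma mono_mem {n : ℕ} (K : Type*) [Field K] (S : Set (Mon n)) (m : Mon n) :
    monomial m (1 : K) ∈ Ideal.span ((fun w => monomial w (1 : K)) '' S) ↔ ∃ p ∈ S, p ≤ m := by
  classical
  rw [MvPolynomial.mem_ideal_span_monomial_image]
  simp [MvPolynomial.support_monomial]

lemma deg_kSums {n l d k : ℕ} {a : ℕ → ℕ} (m : Mon n) (hm : m ∈ kSums (lexSeg n l d a) k) :
    deg m = k * d := by
  obtain ⟨T, hT, hL, rfl⟩ := hm
  induction T using Multiset.induction_on generalizing k with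
  | empty => simp at hT; subst hT; simp [deg_eq]
  | cons e T ih =>
    rw [Multiset.card_cons] at hT
    rw [Multiset.sum_cons, deg_add, ih rfl (fun e he => hL e (by simp [he])),
      (hL e (by simp)).1, ← hT]
    ring

lemma minGens_eq {n l d k : ℕ} {a : ℕ → ℕ} (K : Type*) [Field K] :
    minGens K ((lexIdeal n l d a K) ^ k) = kSums (lexSeg n l d a) k := by
  ext m
  rw [lexIdeal, span_pow_eq, minGens, Set.mem_ofPred_eq]
  simp only [mono_mem]
  constructor
  · rintro ⟨⟨p, hp, hpm⟩, h⟩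
    by_cases he : p = m
    · exact he ▸ hp
    · exfalso
      obtain ⟨i, -, hi⟩ := first_diff p m he
      have hle : p i ≤ m i := hpm i
      refine h i (by simp; omega) ⟨p, hp, fun j => ?_⟩
      have := hpm j
      rw [Finsupp.tsub_apply, Finsupp.single_apply]
      split_ifs with hij
      · subst hij; omega
      · simpa using this
  · intro hm
    refine ⟨⟨m, hm, le_rfl⟩, ?_⟩
    rintro i hi ⟨p, hp, hpm⟩
    have hmi : m i ≠ 0 := by simpa using hi
    have := deg_lt_of p m (fun j => (hpm j).trans (by simp)) i (by
      have := hpm i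
      simp at this
      omega)
    rw [deg_kSums p hp, deg_kSums m hm] at this
    omega

lemma exists_mem_of_sum {n : ℕ} (T : Multiset (Mon n)) (t : Fin n) (h : 1 ≤ T.sum t) :
    ∃ e ∈ T, 1 ≤ e t := by
  induction T using Multiset.induction_on with
  | empty => simp at h
  | cons e T ih =>
    rw [Multiset.sum_cons, Finsupp.add_apply] at h
    by_cases he : 1 ≤ e t
    · exact ⟨e, by simp, he⟩
    · obtain ⟨f, hf, hf1⟩ := ih (by omega)
      exact ⟨f, by simp [hf], hf1⟩

lemma exists_two_of_sum {n l : ℕ} (T : Multiset (Mon n))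
    (h : Multiset.card T < deg (lowPart l T.sum)) :
    ∃ e ∈ T, 2 ≤ deg (lowPart l e) := by
  induction T using Multiset.induction_on with
  | empty => simp [low_eq] at h
  | cons e T ih =>
    rw [Multiset.sum_cons, low_add, Multiset.card_cons] at h
    by_cases he : 2 ≤ deg (lowPart l e)
    · exact ⟨e, by simp, he⟩
    · obtain ⟨f, hf, hf1⟩ := ih (by omega)
      exact ⟨f, by simp [hf], hf1⟩

lemma swap_assoc {n : ℕ} (e f : Mon n) (s : ℕ) (t : Fin n) (ht : 1 ≤ e t) :
    (e + sing n s - sing n t) + f = e + f + sing n s - sing n t := by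
  refine add_right_cancel (b := sing n t) ?_
  rw [sub_add_sing (e + f) s t (by simp; omega), add_right_comm, sub_add_sing e s t ht,
    add_right_comm]

lemma swap_swap {n : ℕ} (e h f : Mon n) (s : ℕ) (i t : Fin n) (ht : 1 ≤ e t) (hi : 1 ≤ h i) :
    (e + sing n i - sing n t) + ((h + sing n s - sing n i) + f) =
      e + (h + f) + sing n s - sing n t := by
  refine add_right_cancel (b := sing n t) (add_right_cancel (b := sing n i) ?_)
  rw [sub_add_sing (e + (h + f)) s t (by simp; omega)]
  generalize hA : e + sing n i - sing n t = A
  generalize hB : h + sing n s - sing n i = B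
  have h1 : A + sing n t = e + sing n i := hA ▸ sub_add_sing e i t ht
  have h2 : B + sing n i = h + sing n s := hB ▸ sub_add_sing h s i hi
  calc A + (B + f) + sing n t + sing n i = (A + sing n t) + ((B + sing n i) + f) := by ac_rfl
    _ = _ := by rw [h1, h2]; ac_rfl

lemma exchange {n l d k : ℕ} {a : ℕ → ℕ} (hd : 2 ≤ d) (hl2 : 2 ≤ l) (hln : l ≤ n - 1)
    (m : Mon n) (hm : m ∈ kSums (lexSeg n l d a) k) (t : Fin n) (htl : (t : ℕ) < l)
    (hmt : 1 ≤ m t) (hmin : ∀ i : Fin n, i < t → m i = 0) (s : ℕ) (hts : (t : ℕ) < s) (hs : s < n)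
    (hlow : k ≤ deg (lowPart l (m + sing n s - sing n t))) :
    m + sing n s - sing n t ∈ kSums (lexSeg n l d a) k := by
  obtain ⟨T, hT, hL, rfl⟩ := hm
  obtain ⟨e, heT, het⟩ := exists_mem_of_sum T t hmt
  obtain ⟨T', rfl⟩ := Multiset.exists_cons_of_mem heT
  rw [Multiset.card_cons] at hT
  have heL := hL e (by simp)
  have h0 : (t : ℕ) ≠ 0 → ∀ i : Fin n, (i : ℕ) = 0 → e i = 0 := by
    intro ht i hi
    have := hmin i (Fin.lt_def.2 (by omega))
    rw [Multiset.sum_cons, Finsupp.add_apply] at this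
    omega
  have one : e + sing n s - sing n t ∈ lexSeg n l d a →
      (e ::ₘ T').sum + sing n s - sing n t ∈ kSums (lexSeg n l d a) k := by
    intro h
    refine ⟨(e + sing n s - sing n t) ::ₘ T', by simpa using hT, ?_, ?_⟩
    · intro f hf
      rcases Multiset.mem_cons.1 hf with h' | h'
      · exact h' ▸ h
      · exact hL f (by simp [h'])
    · rw [Multiset.sum_cons, Multiset.sum_cons, swap_assoc e _ s t het]
  rcases lt_or_ge s l with hsl | hsl
  · exact one (swap_low hd hl2 hln e heL t het h0 s (by omega) hsl)
  by_cases he2 : 2 ≤ deg (lowPart l e)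
  · exact one (swap_high hd hl2 hln e heL t het he2 s hsl hs)
  have hlow' := congrArg (fun x => deg (lowPart l x)) (sub_add_sing (e ::ₘ T').sum s t hmt)
  simp only [low_add, Multiset.sum_cons] at hlow'
  rw [low_sing hs, low_sing t.2, if_neg (not_lt.2 hsl), if_pos htl] at hlow'
  rw [Multiset.sum_cons] at hlow
  obtain ⟨h, hhT, hh2⟩ := exists_two_of_sum (l := l) T' (by omega)
  obtain ⟨T'', rfl⟩ := Multiset.exists_cons_of_mem hhT
  have hhL := hL h (by simp)
  obtain ⟨i, hil, hi⟩ := exists_of_low h (by omega : 1 ≤ deg (lowPart l h))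
  have hi0 : (i : ℕ) ≠ 0 := by
    intro hi0
    have := zero_of_low_two hl2 hln h hhL hh2 i hi0
    omega
  refine ⟨(e + sing n i - sing n t) ::ₘ (h + sing n s - sing n i) ::ₘ T'', by simpa using hT, ?_, ?_⟩
  · intro f hf
    rcases Multiset.mem_cons.1 hf with h' | h'
    · exact h' ▸ swap_low hd hl2 hln e heL t het h0 i (by omega) hil
    rcases Multiset.mem_cons.1 h' with h' | h'
    · exact h' ▸ swap_high hd hl2 hln h hhL i hi hh2 s hsl hs
    · exact hL f (by simp [h'])
  · simp only [Multiset.sum_cons]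
    exact swap_swap e h _ s i t het hi

end aux

/-- If `m ∈ G(I^k)`, `s ∈ set(m)` and `x_s·m/x_{min(m)} ⪰ v^k`, then
`g(x_s·m) = x_s·m/x_{min(m)}`: the latter lies in `G(I^k)` and every
`w ∈ G(I^k)` dividing `x_s·m` satisfies `w ≥_revlex x_s·m/x_{min(m)}`. -/
theorem stmt9 (n d l k : ℕ) (K : Type*) [Field K] (a : ℕ → ℕ)
    (hd : 2 ≤ d) (hl2 : 2 ≤ l) (hln : l ≤ n - 1)
    (hsum : ∑ j ∈ Finset.Ico l n, a j = d - 1) (hk : 1 ≤ k) :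
    ∀ m ∈ minGens K ((lexIdeal n l d a K) ^ k),
      ∀ s ∈ setOfGen K ((lexIdeal n l d a K) ^ k) m,
        ¬ precLT l (m + sing n s - sing n (minIdx m)) (k • vVec n l d) →
          m + sing n s - sing n (minIdx m) ∈ minGens K ((lexIdeal n l d a K) ^ k) ∧
          ∀ w ∈ minGens K ((lexIdeal n l d a K) ^ k), w ≤ m + sing n s →
            revLE (m + sing n s - sing n (minIdx m)) w := by
  intro m hm s hs hprec
  obtain ⟨hsn, hsb⟩ := hs
  rw [minGens_eq] at hm ⊢
  rw [idealBelow, mono_mem, minGens_eq] at hsb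
  obtain ⟨z, ⟨hz, r, hr, hrlt⟩, hzle⟩ := hsb
  -- the low index
  obtain ⟨i₀, hi₀, hmi₀⟩ : ∃ i : Fin n, (i : ℕ) < l ∧ 1 ≤ m i := by
    obtain ⟨T, hT, hL, rfl⟩ := hm
    obtain ⟨e, he⟩ := Multiset.card_pos_iff_exists_mem.1 (by omega : 0 < Multiset.card T)
    obtain ⟨i, hi, hei⟩ := exists_of_low e (seg_prop hl2 hln e (hL e he)).1
    obtain ⟨T', rfl⟩ := Multiset.exists_cons_of_mem he
    exact ⟨i, hi, by simp; omega⟩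
  obtain ⟨htn, hmt0⟩ : minIdx m ∈ {j : ℕ | ∃ h : j < n, m ⟨j, h⟩ ≠ 0} :=
    Nat.sInf_mem ⟨i₀, i₀.2, by simp; omega⟩
  have hmin : ∀ i : Fin n, m i ≠ 0 → minIdx m ≤ i := fun i hi => Nat.sInf_le ⟨i.2, hi⟩
  obtain ⟨t, ht⟩ : ∃ t : Fin n, (t : ℕ) = minIdx m := ⟨⟨_, htn⟩, rfl⟩
  have hmt : 1 ≤ m t := by
    have : t = ⟨minIdx m, htn⟩ := Fin.ext ht
    rw [this]; omega
  rw [← ht] at hprec hmin ⊢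
  clear hmt0 htn ht
  have hts : (t : ℕ) < s := by
    have hrs : (r : ℕ) = s := by
      by_contra hc
      have := hzle r
      rw [Finsupp.add_apply, sing_app, if_neg hc] at this
      omega
    have : ∃ j, z j < m j := by
      by_contra! hc
      have := deg_lt_of m z hc r hrlt
      rw [deg_kSums m hm, deg_kSums z hz] at this
      omega
    obtain ⟨j, hj⟩ := this
    have h1 : (t : ℕ) ≤ j := hmin j (by omega)
    have h2 : j ≤ r := by
      by_contra hc
      have := hr j (not_le.1 hc)
      omega
    have h3 : j ≠ r := by rintro rfl; omega
    have h4 : j < r := lt_of_le_of_ne h2 h3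
    have h5 : (j : ℕ) < r := h4
    omega
  have hmin' : ∀ i : Fin n, i < t → m i = 0 := by
    intro i hi
    by_contra hc
    have := hmin i hc
    have : (i : ℕ) < t := hi
    omega
  have hmem : m + sing n s - sing n t ∈ kSums (lexSeg n l d a) k := by
    refine exchange hd hl2 hln m hm t (lt_of_le_of_lt (hmin i₀ (by omega)) hi₀) hmt hmin' s hts hsn ?_
    by_contra hc
    refine hprec (Or.inl ?_)
    rw [low_smul, low_v hl2 hln]
    omega
  refine ⟨hmem, fun w hw hwle => ?_⟩
  by_cases he : m + sing n s - sing n t = w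
  · exact Or.inl he
  right
  obtain ⟨j, hj, hne⟩ := last_diff _ _ he
  refine ⟨j, hj, ?_⟩
  by_contra hc
  have hlt : (m + sing n s - sing n t) j < w j := by omega
  have hjt : j = t := by
    by_contra hjt
    have h1 := hwle j
    rw [Finsupp.tsub_apply, sing_app, if_neg (fun h => hjt (Fin.ext h))] at hlt
    omega
  subst hjt
  have := deg_lt_of _ w (fun i => by
    rcases lt_trichotomy i j with h | h | h
    · have h' : (i : ℕ) < j := h
      rw [Finsupp.tsub_apply, Finsupp.add_apply, hmin' i h, sing_app, if_neg (by omega)]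
      simp
    · rw [h]; exact hlt.le
    · exact (hj i h).le) j hlt
  rw [deg_kSums _ hmem, deg_kSums w hw] at this
  omega
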